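/- arXiv:math/0311290 — 2 statements merged into one kernel-verified Lean document; each statement's English description precedes it below -/
import Mathlib

section
/- Suppose α > 0 and n ≥ 1. Then the Jack_α probability that the largest part λ'_1 of the conjugate partition (i.e., the number of parts of λ) is at least 2e·√(αn) is at most n²/(α·4^{2e·√(αn)}); that is, Σ_{λ partition of n with λ'_1 ≥ 2e·√(αn)} π_α(λ) ≤ n²/(α·4^{2e·√(αn)}). -/
open Finset

namespace JackTest

def colLen {n : ℕ} (lam : n.Partition) (j : ℕ) : ℕ :=
  (lam.parts.filter (fun p => j < p)).card

def rowLen {n : ℕ} (lam : n.Partition) (i : ℕ) : ℕ :=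
  ((Finset.range n).filter (fun j => i < colLen lam j)).card

def cells {n : ℕ} (lam : n.Partition) : Finset (ℕ × ℕ) :=
  (Finset.range n ×ˢ Finset.range n).filter (fun s => s.2 < rowLen lam s.1)

def arm {n : ℕ} (lam : n.Partition) (s : ℕ × ℕ) : ℕ := rowLen lam s.1 - (s.2 + 1)

def leg {n : ℕ} (lam : n.Partition) (s : ℕ × ℕ) : ℕ := colLen lam s.2 - (s.1 + 1)

noncomputable def cLow (α : ℝ) {n : ℕ} (lam : n.Partition) : ℝ :=
  ∏ s ∈ cells lam, (α * arm lam s + leg lam s + 1)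

noncomputable def cUp (α : ℝ) {n : ℕ} (lam : n.Partition) : ℝ :=
  ∏ s ∈ cells lam, (α * arm lam s + leg lam s + α)

noncomputable def jackP (α : ℝ) {n : ℕ} (lam : n.Partition) : ℝ :=
  α ^ n * (n.factorial) / (cLow α lam * cUp α lam)

def nStat {n : ℕ} (lam : n.Partition) : ℕ := ∑ i ∈ Finset.range n, i * rowLen lam i

def nStatConj {n : ℕ} (lam : n.Partition) : ℕ := ∑ j ∈ Finset.range n, j * colLen lam j

noncomputable def W (α : ℝ) {n : ℕ} (lam : n.Partition) : ℝ :=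
  (α * nStatConj lam - nStat lam) / Real.sqrt (α * n.choose 2)

noncomputable def Phi (x : ℝ) : ℝ :=
  (Real.sqrt (2 * Real.pi))⁻¹ * ∫ t in Set.Iic x, Real.exp (-t ^ 2 / 2)



/-! ### Lagrange interpolation identities -/

section Interpolation

open Polynomial

/-- The top three coefficients of `∏ (X - x i)` and of its translate `∏ (X - (x i + 1))`. -/
theorem coeff_X_sq_mul_prod {ι : Type*} [DecidableEq ι] (s : Finset ι) (x : ι → ℝ) :
    ∃ b : ℝ,
      (∀ m, #s + 2 < m → ((X : ℝ[X]) ^ 2 * ∏ i ∈ s, (X - C (x i))).coeff m = 0) ∧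
      ((X : ℝ[X]) ^ 2 * ∏ i ∈ s, (X - C (x i))).coeff (#s + 2) = 1 ∧
      ((X : ℝ[X]) ^ 2 * ∏ i ∈ s, (X - C (x i))).coeff (#s + 1) = -∑ i ∈ s, x i ∧
      ((X : ℝ[X]) ^ 2 * ∏ i ∈ s, (X - C (x i))).coeff #s = b ∧
      (∀ m, #s + 2 < m → ((X : ℝ[X]) ^ 2 * ∏ i ∈ s, (X - C (x i + 1))).coeff m = 0) ∧
      ((X : ℝ[X]) ^ 2 * ∏ i ∈ s, (X - C (x i + 1))).coeff (#s + 2) = 1 ∧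
      ((X : ℝ[X]) ^ 2 * ∏ i ∈ s, (X - C (x i + 1))).coeff (#s + 1) = -∑ i ∈ s, x i - #s ∧
      ((X : ℝ[X]) ^ 2 * ∏ i ∈ s, (X - C (x i + 1))).coeff #s =
        b + (#s - 1) * ∑ i ∈ s, x i + #s * (#s - 1) / 2 := by
  have step : ∀ (P : ℝ[X]) (c : ℝ) (m : ℕ),
      ((X - C c) * P).coeff (m + 1) = P.coeff m - c * P.coeff (m + 1) := by
    intro P c m
    rw [sub_mul, coeff_sub, coeff_X_mul, coeff_C_mul]
  induction s using Finset.induction_on with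
  | empty =>
    refine ⟨0, ?_⟩
    simp only [card_empty, prod_empty, mul_one, sum_empty, coeff_X_pow]
    refine ⟨fun m hm => by rw [if_neg (by omega)], by simp, by simp, by simp,
      fun m hm => by rw [if_neg (by omega)], by simp, by simp, by simp⟩
  | insert a s ha ih =>
    obtain ⟨b, h1, h2, h3, h4, h5, h6, h7, h8⟩ := ih
    have e1 : (X : ℝ[X]) ^ 2 * ∏ i ∈ insert a s, (X - C (x i)) =
        (X - C (x a)) * (X ^ 2 * ∏ i ∈ s, (X - C (x i))) := by
      rw [prod_insert ha]; ring
    have e2 : (X : ℝ[X]) ^ 2 * ∏ i ∈ insert a s, (X - C (x i + 1)) =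
        (X - C (x a + 1)) * (X ^ 2 * ∏ i ∈ s, (X - C (x i + 1))) := by
      rw [prod_insert ha]; ring
    rw [e1, e2, card_insert_of_notMem ha, sum_insert ha]
    refine ⟨b + x a * ∑ i ∈ s, x i, ?_, ?_, ?_, ?_, ?_, ?_, ?_, ?_⟩
    · intro m hm
      obtain ⟨m, rfl⟩ : ∃ q, m = q + 1 := ⟨m - 1, by omega⟩
      rw [step, h1 m (by omega), h1 (m + 1) (by omega)]; ring
    · rw [show #s + 1 + 2 = #s + 2 + 1 by ring, step, h2, h1 _ (by omega)]; ring
    · rw [step, h2, h3]; ring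
    · rw [step, h4, h3]; ring
    · intro m hm
      obtain ⟨m, rfl⟩ : ∃ q, m = q + 1 := ⟨m - 1, by omega⟩
      rw [step, h5 m (by omega), h5 (m + 1) (by omega)]; ring
    · rw [show #s + 1 + 2 = #s + 2 + 1 by ring, step, h6, h5 _ (by omega)]; ring
    · rw [step, h6, h7]; push_cast; ring
    · rw [step, h8, h7]; push_cast; ring

/-- The sum of the (unnormalised) down-transition weights. -/
theorem sum_mul_prod_sub_one_div {ι : Type*} [DecidableEq ι] (s : Finset ι) (x : ι → ℝ)
    (hx : Set.InjOn x s) (c : ℝ) :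
    ∑ i ∈ s, (x i - 1 + c) * ∏ j ∈ s.erase i, ((x i - x j - 1) / (x i - x j)) =
      ∑ i ∈ s, x i + #s * c - #s * (#s + 1) / 2 := by
  rcases s.eq_empty_or_nonempty with rfl | hs
  · simp
  obtain ⟨b, h1, h2, h3, h4, h5, h6, h7, h8⟩ := coeff_X_sq_mul_prod s x
  set D : ℝ[X] := ∏ i ∈ s, (X - C (x i)) with hD
  set E : ℝ[X] := ∏ i ∈ s, (X - C (x i + 1)) with hE
  set T : ℝ[X] := (X + C (c - 1 - #s)) * D - (X + C (c - 1)) * E with hT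
  have step : ∀ m, (X ^ 2 * T).coeff (m + 1) =
      (X ^ 2 * D).coeff m + (c - 1 - #s) * (X ^ 2 * D).coeff (m + 1) -
        ((X ^ 2 * E).coeff m + (c - 1) * (X ^ 2 * E).coeff (m + 1)) := by
    intro m
    have : X ^ 2 * T = X * (X ^ 2 * D) + C (c - 1 - #s) * (X ^ 2 * D) -
        (X * (X ^ 2 * E) + C (c - 1) * (X ^ 2 * E)) := by rw [hT]; ring
    rw [this]
    simp only [coeff_sub, coeff_add, coeff_X_mul, coeff_C_mul]
  have hshift : ∀ m, T.coeff m = (X ^ 2 * T).coeff (m + 2) := fun m =>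
    (coeff_X_pow_mul T 2 m).symm
  have hpos : 0 < #s := hs.card_pos
  have hdeg : T.degree < #s := by
    rw [degree_lt_iff_coeff_zero]
    intro m hm
    rw [hshift, show m + 2 = m + 1 + 1 by ring, step]
    rcases Nat.lt_or_ge #s m with hm' | hm'
    · rcases Nat.lt_or_ge (#s + 1) m with hm'' | hm''
      · rw [h1 _ (by omega), h1 _ (by omega), h5 _ (by omega), h5 _ (by omega)]; ring
      · obtain rfl : m = #s + 1 := by omega
        rw [h1 (#s + 1 + 1 + 1) (by omega), h5 (#s + 1 + 1 + 1) (by omega),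
          show #s + 1 + 1 = #s + 2 by rfl, h2, h6]
        ring
    · obtain rfl : m = #s := by omega
      rw [h2, h3, h6, h7]; ring
  have key := Lagrange.coeff_eq_sum hx hdeg
  have hc : T.coeff (#s - 1) = ∑ i ∈ s, x i + #s * c - #s * (#s + 1) / 2 := by
    rw [hshift, show #s - 1 + 2 = #s + 1 by omega, step, h4, h3, h8, h7]; ring
  rw [← hc, key]
  refine sum_congr rfl fun i hi => ?_
  rw [prod_div_distrib, mul_div_assoc']
  congr 1
  have hDi : D.eval (x i) = 0 := by
    rw [hD, eval_prod]; exact prod_eq_zero hi (by simp)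
  have hEi : E.eval (x i) = -∏ j ∈ s.erase i, (x i - x j - 1) := by
    rw [hE, eval_prod, ← mul_prod_erase s _ hi]
    simp only [eval_sub, eval_X, eval_C]
    rw [show x i - (x i + 1) = -1 by ring, neg_one_mul]
    congr 1
    exact prod_congr rfl fun j _ => by ring
  rw [hT, eval_sub, eval_mul, eval_mul, hDi, hEi]
  simp only [eval_add, eval_X, eval_C]
  ring

/-- The sum of the up-transition weights is `1`, with an additional node `c`. -/
theorem sum_prod_add_one_div {ι : Type*} [DecidableEq ι] (s : Finset ι) (x : ι → ℝ)
    (hx : Set.InjOn x s) (c : ℝ) (hc : ∀ i ∈ s, x i ≠ c) :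
    ∑ i ∈ s, (∏ j ∈ s.erase i, ((x i - x j + 1) / (x i - x j))) / (x i - c) +
      ∏ j ∈ s, ((c - x j + 1) / (c - x j)) = 1 := by
  set v : Option ι → ℝ := fun o => o.elim c x with hv
  have hinj : Set.InjOn v (insertNone s : Finset (Option ι)) := by
    rintro (_ | i) hi (_ | j) hj h
    · rfl
    · exact absurd h.symm (hc j (by simpa using hj))
    · exact absurd h (hc i (by simpa using hi))
    · exact congrArg some (hx (by simpa using hi) (by simpa using hj) h)
  set P : ℝ[X] := ∏ j ∈ s, (X - C (x j - 1)) with hP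
  have hmonic : P.Monic := monic_prod_of_monic _ _ fun j _ => monic_X_sub_C _
  have hnat : P.natDegree = #s := by
    rw [hP, natDegree_prod_of_monic _ _ fun j _ => monic_X_sub_C _]
    simp only [natDegree_X_sub_C, sum_const, smul_eq_mul, mul_one]
  have key := Lagrange.leadingCoeff_eq_sum (P := P) hinj (by
    rw [degree_eq_natDegree hmonic.ne_zero, hnat, card_insertNone]; norm_cast)
  have hev : ∀ z, P.eval z = ∏ j ∈ s, (z - x j + 1) := by
    intro z
    rw [hP, eval_prod]
    exact prod_congr rfl fun j _ => by simp; ring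
  rw [hmonic.leadingCoeff, sum_insertNone] at key
  refine Eq.trans ?_ key.symm
  rw [add_comm]
  congr 1
  · rw [prod_div_distrib, hev]
    congr 1
    rw [show (insertNone s).erase none = s.map Function.Embedding.some by
      ext o; cases o <;> simp, prod_map]
    rfl
  · refine sum_congr rfl fun i hi => ?_
    rw [show (insertNone s).erase (some i) = insertNone (s.erase i) by
      ext o; cases o <;> simp, prod_insertNone, prod_div_distrib, div_div, hev,
      ← mul_prod_erase s _ hi]
    simp only [hv, Option.elim]
    rw [sub_self, zero_add, one_mul, mul_comm (x i - c)]

end Interpolation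

/-! ### The row formula for the weights and its behaviour under adding a box -/

/-- The generalised rising factorial `∏_{a < x} (α a + t)`. -/
noncomputable def rising (α t : ℝ) (x : ℕ) : ℝ := ∏ a ∈ range x, (α * a + t)

theorem rising_zero (α t : ℝ) : rising α t 0 = 1 := by simp [rising]

theorem rising_succ (α t : ℝ) (x : ℕ) :
    rising α t (x + 1) = rising α t x * (α * x + t) := by
  rw [rising, prod_range_succ, rising]

theorem rising_pos {α t : ℝ} (hα : 0 < α) (ht : 0 < t) (x : ℕ) : 0 < rising α t x :=
  prod_pos fun a _ => by positivity

/-- The contribution of two rows at vertical distance `d` whose lengths differ by `x`. -/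
noncomputable def pairFactor (α : ℝ) (x : ℕ) (d : ℝ) : ℝ :=
  rising α d x / rising α (d + 1) x * (rising α (d - 1 + α) x / rising α (d + α) x)

/-- The multiplicative change of `pairFactor` when the content difference is increased by `α`. -/
noncomputable def pairRatio (α u : ℝ) : ℝ := u * (u - 1 + α) / ((u + α) * (u + 1))

theorem pairFactor_zero (α d : ℝ) : pairFactor α 0 d = 1 := by simp [pairFactor, rising_zero]

theorem pairFactor_pos {α : ℝ} (hα : 0 < α) (x : ℕ) {d : ℝ} (hd : 1 ≤ d) :
    0 < pairFactor α x d := by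
  have h1 := rising_pos hα (show 0 < d by linarith) x
  have h2 := rising_pos hα (show 0 < d + 1 by linarith) x
  have h3 := rising_pos hα (show 0 < d - 1 + α by linarith) x
  have h4 := rising_pos hα (show 0 < d + α by linarith) x
  unfold pairFactor
  positivity

theorem pairFactor_succ {α : ℝ} (x : ℕ) (d : ℝ) :
    pairFactor α (x + 1) d = pairFactor α x d * pairRatio α (α * x + d) := by
  unfold pairFactor pairRatio
  simp only [rising_succ]
  rw [mul_div_mul_comm, mul_div_mul_comm (rising α (d - 1 + α) x),
    mul_comm (α * x + d + α) (α * x + d + 1), mul_div_mul_comm (α * (x : ℝ) + d)]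
  ring

theorem pairRatio_mul_pairRatio_neg {α v : ℝ} (hα : 0 < α) (hv : 1 ≤ v) :
    pairRatio α v * pairRatio α (-(v + α)) = 1 := by
  have h1 : v ≠ 0 := by linarith
  have h2 : v - 1 + α ≠ 0 := by linarith
  have h3 : v + α ≠ 0 := by linarith
  have h4 : v + 1 ≠ 0 := by linarith
  have h5 : -(v + α) + 1 ≠ 0 := by linarith
  have e1 : pairRatio α (-(v + α)) = (v + α) * (v + 1) / (v * (v - 1 + α)) := by
    have h6 : -(v + α) + α ≠ 0 := by ring_nf; simpa using h1
    unfold pairRatio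
    rw [div_eq_div_iff (mul_ne_zero h6 h5) (mul_ne_zero h1 h2)]
    ring
  rw [e1, pairRatio]
  field_simp

/-- The product `c_λ · c'_λ` for the partition with rows `r`, expressed through `r`. -/
noncomputable def rowWeight (α : ℝ) {k : ℕ} (r : Fin k → ℕ) : ℝ :=
  (∏ i : Fin k, rising α ((k : ℝ) - i) (r i) * rising α ((k : ℝ) - i - 1 + α) (r i)) *
    ∏ i : Fin k, ∏ m : Fin k,
      if i < m then pairFactor α (r i - r m) ((m : ℝ) - i) else 1

theorem one_le_cast_sub {a b : ℕ} (h : a < b) : (1 : ℝ) ≤ (b : ℝ) - a := by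
  have : (a : ℝ) + 1 ≤ b := by exact_mod_cast h
  linarith

theorem rowWeight_pos {α : ℝ} (hα : 0 < α) {k : ℕ} (r : Fin k → ℕ) : 0 < rowWeight α r := by
  refine mul_pos (prod_pos fun i _ => ?_) (prod_pos fun i _ => prod_pos fun m _ => ?_)
  · have := one_le_cast_sub i.isLt
    exact mul_pos (rising_pos hα (by linarith) _) (rising_pos hα (by linarith) _)
  · split_ifs with h
    · exact pairFactor_pos hα _ (one_le_cast_sub h)
    · exact one_pos

theorem rowWeight_zero (α : ℝ) {k : ℕ} : rowWeight α (0 : Fin k → ℕ) = 1 := by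
  simp [rowWeight, rising_zero, pairFactor_zero]

/-- A product over ordered pairs in which only the pairs containing `a` change. -/
theorem prod_prod_lt_eq_mul {k : ℕ} (G G' : Fin k → Fin k → ℝ) (ρ : Fin k → ℝ) (a : Fin k)
    (h₀ : ∀ i m, i < m → i ≠ a → m ≠ a → G' i m = G i m)
    (h₁ : ∀ m, a < m → G' a m = G a m * ρ m)
    (h₂ : ∀ i, i < a → G' i a = G i a * ρ i) :
    (∏ i, ∏ m, if i < m then G' i m else 1) =
      (∏ i, ∏ m, if i < m then G i m else 1) * ∏ j ∈ univ.erase a, ρ j := by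
  set τ : Fin k → Fin k → ℝ := fun i m =>
    if i < m then (if i = a then ρ m else if m = a then ρ i else 1) else 1 with hτ
  have hG : ∀ i m, (if i < m then G' i m else 1) = (if i < m then G i m else 1) * τ i m := by
    intro i m
    simp only [hτ]
    split_ifs with h hi hm
    · subst hi; exact h₁ m h
    · subst hm; exact h₂ i h
    · rw [h₀ i m h hi hm, mul_one]
    · rw [mul_one]
  simp only [hG, prod_mul_distrib]
  congr 1
  rw [← mul_prod_erase univ _ (mem_univ a), ← mul_prod_erase univ (τ a) (mem_univ a),
    show τ a a = 1 by simp [hτ], one_mul, ← prod_mul_distrib]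
  refine prod_congr rfl fun j hj => ?_
  have hja : j ≠ a := ne_of_mem_erase hj
  rw [prod_eq_single a (fun m _ hm => by simp [hτ, hja, hm]) (by simp)]
  rcases lt_or_gt_of_ne hja with h | h
  · simp [hτ, h, h.not_gt, hja]
  · simp [hτ, h, h.not_gt]

/-- The `α`-content of the first box to the right of row `i`. -/
noncomputable def content (α : ℝ) {k : ℕ} (r : Fin k → ℕ) (i : Fin k) : ℝ := α * r i - i

theorem content_sub_of_lt {α : ℝ} {k : ℕ} {r : Fin k → ℕ} (hr : Antitone r) {i j : Fin k}
    (h : i < j) :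
    content α r i - content α r j = α * ((r i - r j : ℕ) : ℝ) + ((j : ℝ) - i) := by
  rw [Nat.cast_sub (hr h.le)]; unfold content; ring

theorem content_strictAnti {α : ℝ} (hα : 0 < α) {k : ℕ} {r : Fin k → ℕ} (hr : Antitone r) :
    StrictAnti (content α r) := by
  intro i j h
  have h1 := content_sub_of_lt (α := α) hr h
  have h2 : (1 : ℝ) ≤ (j : ℝ) - i := one_le_cast_sub h
  have h3 : 0 ≤ α * ((r i - r j : ℕ) : ℝ) := by positivity
  linarith

theorem content_add_pos {α : ℝ} (hα : 0 < α) {k : ℕ} (r : Fin k → ℕ) (i : Fin k) :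
    1 ≤ content α r i + k := by
  have h2 : (1 : ℝ) ≤ (k : ℝ) - i := one_le_cast_sub i.isLt
  have h3 : 0 ≤ α * (r i : ℝ) := by positivity
  unfold content; linarith

/-- The shape obtained by adding a box to row `a`. -/
def addBox {k : ℕ} (r : Fin k → ℕ) (a : Fin k) : Fin k → ℕ := Function.update r a (r a + 1)

theorem addBox_self {k : ℕ} (r : Fin k → ℕ) (a : Fin k) : addBox r a a = r a + 1 := by
  simp [addBox]

theorem addBox_of_ne {k : ℕ} (r : Fin k → ℕ) {a i : Fin k} (h : i ≠ a) :
    addBox r a i = r i := by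
  simp [addBox, h]

theorem rowWeight_addBox {α : ℝ} (hα : 0 < α) {k : ℕ} {r : Fin k → ℕ} (hr : Antitone r)
    {a : Fin k} (hr' : Antitone (addBox r a)) :
    rowWeight α (addBox r a) = rowWeight α r *
      ((content α r a + k) * (content α r a + α + k - 1) *
        ∏ j ∈ univ.erase a, pairRatio α (content α r a - content α r j)) := by
  have hpair := prod_prod_lt_eq_mul
    (fun i m => pairFactor α (r i - r m) ((m : ℝ) - i))
    (fun i m => pairFactor α (addBox r a i - addBox r a m) ((m : ℝ) - i))
    (fun j => pairRatio α (content α r a - content α r j)) a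
    (fun i m _ hi hm => by simp only [addBox_of_ne r hi, addBox_of_ne r hm])
    (fun m hm => by
      simp only [addBox_self, addBox_of_ne r hm.ne']
      rw [Nat.sub_add_comm (hr hm.le), pairFactor_succ, content_sub_of_lt hr hm])
    (fun i hi => by
      simp only [addBox_self, addBox_of_ne r hi.ne]
      have hle : r a + 1 ≤ r i := by
        have := hr' hi.le
        rwa [addBox_self, addBox_of_ne r hi.ne] at this
      obtain ⟨y, hy⟩ := Nat.exists_eq_add_of_le hle
      have hd : (1 : ℝ) ≤ (a : ℝ) - i := one_le_cast_sub hi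
      rw [show r i - (r a + 1) = y by omega, show r i - r a = y + 1 by omega,
        pairFactor_succ, mul_assoc]
      have he : content α r a - content α r i = -(α * y + ((a : ℝ) - i) + α) := by
        rw [← neg_sub, content_sub_of_lt hr hi, show r i - r a = y + 1 by omega]
        push_cast; ring
      have hy0 : 0 ≤ α * (y : ℝ) := by positivity
      rw [he, pairRatio_mul_pairRatio_neg hα (by linarith), mul_one])
  unfold rowWeight
  rw [hpair, ← mul_prod_erase univ _ (mem_univ a),
    ← mul_prod_erase univ (fun i : Fin k => rising α ((k : ℝ) - i) (r i) *
      rising α ((k : ℝ) - i - 1 + α) (r i)) (mem_univ a),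
    addBox_self, rising_succ, rising_succ,
    prod_congr rfl fun (i : Fin k) (hi : i ∈ univ.erase a) => by
      rw [addBox_of_ne r (ne_of_mem_erase hi)]]
  unfold content
  ring

/-- The up-transition weight for adding a box to row `a`. -/
noncomputable def upProb (α : ℝ) {k : ℕ} (r : Fin k → ℕ) (a : Fin k) : ℝ :=
  (∏ j ∈ univ.erase a, ((content α r a - content α r j + 1) /
    (content α r a - content α r j))) / (content α r a - -k)

/-- The unnormalised down-transition weight for removing a box from row `a`. -/
noncomputable def downProb (α : ℝ) {k : ℕ} (r : Fin k → ℕ) (a : Fin k) : ℝ :=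
  (content α r a - 1 + k) * ∏ j ∈ univ.erase a, ((content α r a - content α r j - 1) /
    (content α r a - content α r j))

theorem sum_upProb_le_one {α : ℝ} (hα : 0 < α) {k : ℕ} {r : Fin k → ℕ} (hr : Antitone r) :
    ∑ a, upProb α r a ≤ 1 := by
  have h := sum_prod_add_one_div univ (content α r)
    (content_strictAnti hα hr).injective.injOn (-(k : ℝ)) (fun i _ => by
      have := content_add_pos hα r i
      linarith)
  have h2 : 0 ≤ ∏ j, ((-(k : ℝ) - content α r j + 1) / (-(k : ℝ) - content α r j)) :=
    prod_nonneg fun j _ => by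
      have := content_add_pos hα r j
      exact div_nonneg_of_nonpos (by linarith) (by linarith)
  unfold upProb
  linarith

theorem sum_downProb {α : ℝ} (hα : 0 < α) {k : ℕ} {r : Fin k → ℕ} (hr : Antitone r) :
    ∑ a, downProb α r a = α * ∑ a, (r a : ℝ) := by
  have h := sum_mul_prod_sub_one_div univ (content α r)
    (content_strictAnti hα hr).injective.injOn (k : ℝ)
  have hs : ∑ i : Fin k, ((i : ℕ) : ℝ) = k * (k - 1) / 2 := by
    rw [Fin.sum_univ_eq_sum_range (fun i => (i : ℝ))]
    clear h hr r
    induction k with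
    | zero => simp
    | succ k ih => rw [sum_range_succ, ih]; push_cast; ring
  unfold downProb
  rw [h]
  simp only [content, sum_sub_distrib, ← mul_sum, hs, card_univ, Fintype.card_fin]
  ring

theorem inv_rowWeight_mul_downProb {α : ℝ} (hα : 0 < α) {k : ℕ} {r : Fin k → ℕ}
    (hr : Antitone r) {a : Fin k} (hr' : Antitone (addBox r a)) :
    (rowWeight α (addBox r a))⁻¹ * downProb α (addBox r a) a =
      (rowWeight α r)⁻¹ * upProb α r a := by
  have ha : content α (addBox r a) a = content α r a + α := by
    unfold content; rw [addBox_self]; push_cast; ring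
  have hj : ∀ j ∈ univ.erase a, content α (addBox r a) j = content α r j := fun j hj => by
    unfold content; rw [addBox_of_ne r (ne_of_mem_erase hj)]
  have hdown : downProb α (addBox r a) a = (content α r a + α - 1 + k) *
      ((∏ j ∈ univ.erase a, pairRatio α (content α r a - content α r j)) *
        ∏ j ∈ univ.erase a, ((content α r a - content α r j + 1) /
          (content α r a - content α r j))) := by
    unfold downProb
    rw [ha, ← prod_mul_distrib]
    congr 1
    refine prod_congr rfl fun j hj' => ?_
    have hja := ne_of_mem_erase hj'
    rw [hj j hj']
    set u := content α r a - content α r j with hu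
    have hu0 : u ≠ 0 := sub_ne_zero.mpr ((content_strictAnti hα hr).injective.ne hja.symm)
    have hu1 : u + 1 ≠ 0 := by
      rcases lt_or_gt_of_ne hja with h | h
      · have h1 := content_sub_of_lt (α := α) hr h
        have h2 : (1 : ℝ) ≤ (a : ℝ) - j := one_le_cast_sub h
        have h3 : r a + 1 ≤ r j := by
          have := hr' h.le
          rwa [addBox_self, addBox_of_ne r h.ne] at this
        have h4 : (0 : ℝ) < ((r j - r a : ℕ) : ℝ) := by
          exact_mod_cast (by omega : 0 < r j - r a)
        have h5 := mul_pos hα h4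
        intro h6
        linarith
      · have := content_strictAnti hα hr h
        intro h6
        linarith
    have e1 : content α r a + α - content α r j = u + α := by rw [hu]; ring
    rw [e1, pairRatio, show u + α - 1 = u - 1 + α by ring]
    by_cases hz : u + α = 0
    · simp [hz]
    · field_simp
  have hW := (rowWeight_pos hα r).ne'
  have hW' := (rowWeight_pos hα (addBox r a)).ne'
  have hk : content α r a + k ≠ 0 := by
    have := content_add_pos hα r a
    linarith
  have hup : upProb α r a * (content α r a + k) = ∏ j ∈ univ.erase a,
      ((content α r a - content α r j + 1) / (content α r a - content α r j)) := by
    unfold upProb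
    rw [sub_neg_eq_add, div_mul_cancel₀ _ hk]
  rw [inv_mul_eq_iff_eq_mul₀ hW', hdown, ← hup, rowWeight_addBox hα hr hr']
  field_simp
  ring

/-! ### The total mass -/

/-- The shapes with `n` boxes in `k` (possibly empty) rows. -/
def shapes (k n : ℕ) : Finset (Fin k → ℕ) :=
  open Classical in (univ.piAntidiag n).filter Antitone

theorem mem_shapes {k n : ℕ} {r : Fin k → ℕ} : r ∈ shapes k n ↔ ∑ i, r i = n ∧ Antitone r := by
  simp [shapes, mem_piAntidiag]

/-- The shape obtained by removing a box from row `a`. -/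
def removeBox {k : ℕ} (r : Fin k → ℕ) (a : Fin k) : Fin k → ℕ := Function.update r a (r a - 1)

theorem addBox_removeBox {k : ℕ} {r : Fin k → ℕ} {a : Fin k} (h : 0 < r a) :
    addBox (removeBox r a) a = r := by
  ext i
  by_cases hi : i = a
  · subst hi; simp [addBox, removeBox]; omega
  · simp [addBox, removeBox, hi]

theorem removeBox_addBox {k : ℕ} (r : Fin k → ℕ) (a : Fin k) :
    removeBox (addBox r a) a = r := by
  ext i
  by_cases hi : i = a
  · subst hi; simp [addBox, removeBox]
  · simp [addBox, removeBox, hi]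

theorem sum_addBox {k : ℕ} (r : Fin k → ℕ) (a : Fin k) :
    ∑ i, addBox r a i = ∑ i, r i + 1 := by
  rw [← add_sum_erase univ _ (mem_univ a), ← add_sum_erase univ r (mem_univ a), addBox_self,
    sum_congr rfl fun i hi => addBox_of_ne r (ne_of_mem_erase hi)]
  ring

theorem upProb_eq_zero {α : ℝ} {k : ℕ} {r : Fin k → ℕ} (hr : Antitone r) {a : Fin k}
    (h : ¬Antitone (addBox r a)) : upProb α r a = 0 := by
  obtain ⟨b, hba, hb⟩ : ∃ b : Fin k, (b : ℕ) + 1 = a ∧ r b = r a := by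
    by_contra! hne
    refine h fun i j hij => ?_
    by_cases hj : j = a
    · by_cases hi : i = a
      · rw [hi, hj]
      · subst hj
        rw [addBox_self, addBox_of_ne r hi]
        have hlt : i < j := lt_of_le_of_ne hij hi
        have hij' : (i : ℕ) < j := hlt
        let b : Fin k := ⟨j - 1, by omega⟩
        have h1 : r b ≠ r j := hne b (by simp only [b]; omega)
        have h2 : r j ≤ r b := hr (show b ≤ j from Fin.le_def.mpr (by simp only [b]; omega))
        have h3 : r b ≤ r i := hr (show i ≤ b from Fin.le_def.mpr (by simp only [b]; omega))
        omega
    · rw [addBox_of_ne r hj]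
      refine (hr hij).trans ?_
      by_cases hi : i = a
      · rw [hi, addBox_self]; omega
      · rw [addBox_of_ne r hi]
  have hne : b ≠ a := fun hh => by rw [hh] at hba; omega
  unfold upProb
  rw [prod_eq_zero (mem_erase.mpr ⟨hne, mem_univ b⟩), zero_div]
  rw [div_eq_zero_iff]
  left
  unfold content
  rw [hb, ← hba]
  push_cast; ring

theorem downProb_eq_zero {α : ℝ} {k : ℕ} {r : Fin k → ℕ} (hr : Antitone r) {a : Fin k}
    (h : ¬(0 < r a ∧ Antitone (removeBox r a))) : downProb α r a = 0 := by
  have hanti : (∀ j, a < j → r j < r a) → Antitone (removeBox r a) := fun hlt i j hij => by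
    unfold removeBox
    by_cases hi : i = a
    · by_cases hj : j = a
      · rw [hi, hj]
      · subst hi
        have := hlt j (lt_of_le_of_ne hij (Ne.symm hj))
        rw [Function.update_self, Function.update_of_ne hj]
        omega
    · rw [Function.update_of_ne hi]
      refine le_trans ?_ (hr hij)
      by_cases hj : j = a
      · rw [hj, Function.update_self]; omega
      · rw [Function.update_of_ne hj]
  by_cases hlast : (a : ℕ) + 1 < k
  · let b : Fin k := ⟨a + 1, hlast⟩
    have hab : a < b := Fin.lt_def.mpr (by simp [b])
    by_cases hb : r b = r a
    · unfold downProb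
      rw [prod_eq_zero (mem_erase.mpr ⟨hab.ne', mem_univ b⟩), mul_zero]
      rw [div_eq_zero_iff]
      left
      unfold content
      rw [hb]
      simp only [b]
      push_cast; ring
    · have hba : r b < r a := lt_of_le_of_ne (hr hab.le) hb
      refine absurd ⟨by omega, hanti fun j hj => ?_⟩ h
      exact (hr (show b ≤ j from Fin.le_def.mpr (Nat.succ_le_of_lt hj))).trans_lt hba
  · have hk : (a : ℕ) + 1 = k := by have := a.isLt; omega
    have h0 : r a = 0 := by
      by_contra h0
      refine h ⟨by omega, hanti fun j hj => ?_⟩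
      have := j.isLt
      have : (a : ℕ) < j := hj
      omega
    unfold downProb content
    have hk' : ((a : ℕ) : ℝ) + 1 = k := by exact_mod_cast hk
    rw [h0, ← hk']
    push_cast
    ring

theorem sum_shapes_downProb {α : ℝ} (hα : 0 < α) {k : ℕ} (n : ℕ) (a : Fin k) :
    ∑ r ∈ shapes k (n + 1), (rowWeight α r)⁻¹ * downProb α r a =
      ∑ r ∈ shapes k n, (rowWeight α r)⁻¹ * upProb α r a := by
  classical
  rw [← sum_filter_of_ne (s := shapes k (n + 1))
      (p := fun r => 0 < r a ∧ Antitone (removeBox r a)) (fun r hr hne => by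
        by_contra hcon
        exact hne (by rw [downProb_eq_zero (mem_shapes.mp hr).2 hcon, mul_zero])),
    ← sum_filter_of_ne (s := shapes k n) (p := fun r => Antitone (addBox r a))
      (fun r hr hne => by
        by_contra hcon
        exact hne (by rw [upProb_eq_zero (mem_shapes.mp hr).2 hcon, mul_zero]))]
  symm
  refine sum_bij' (fun r _ => addBox r a) (fun r _ => removeBox r a) ?_ ?_ ?_ ?_ ?_
  · intro r hr
    obtain ⟨hr1, hr2⟩ := mem_filter.mp hr
    obtain ⟨h1, h2⟩ := mem_shapes.mp hr1
    refine mem_filter.mpr ⟨mem_shapes.mpr ⟨by rw [sum_addBox, h1], hr2⟩, ?_, ?_⟩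
    · rw [addBox_self]; omega
    · rwa [removeBox_addBox]
  · intro r hr
    obtain ⟨hr1, hr2, hr3⟩ := mem_filter.mp hr
    obtain ⟨h1, h2⟩ := mem_shapes.mp hr1
    refine mem_filter.mpr ⟨mem_shapes.mpr ⟨?_, hr3⟩, ?_⟩
    · have := sum_addBox (removeBox r a) a
      rw [addBox_removeBox hr2, h1] at this
      omega
    · rwa [addBox_removeBox hr2]
  · intro r _
    exact removeBox_addBox r a
  · intro r hr
    exact addBox_removeBox (mem_filter.mp hr).2.1
  · intro r hr
    obtain ⟨hr1, hr2⟩ := mem_filter.mp hr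
    exact (inv_rowWeight_mul_downProb hα (mem_shapes.mp hr1).2 hr2).symm

/-- The Jack measure restricted to shapes with at most `k` rows has total mass at most `1`. -/
theorem sum_inv_rowWeight_le {α : ℝ} (hα : 0 < α) (k n : ℕ) :
    α ^ n * n.factorial * ∑ r ∈ shapes k n, (rowWeight α r)⁻¹ ≤ 1 := by
  induction n with
  | zero =>
    have : shapes k 0 = {0} := by
      ext r
      rw [mem_shapes, mem_singleton]
      constructor
      · rintro ⟨h, _⟩
        ext i
        exact (sum_eq_zero_iff.mp h) i (mem_univ i)
      · rintro rfl
        exact ⟨by simp, antitone_const⟩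
    rw [this, sum_singleton, rowWeight_zero]
    simp
  | succ n ih =>
    have h1 : α * ((n + 1 : ℕ) : ℝ) * ∑ r ∈ shapes k (n + 1), (rowWeight α r)⁻¹ =
        ∑ r ∈ shapes k n, (rowWeight α r)⁻¹ * ∑ a, upProb α r a := by
      simp only [mul_sum]
      rw [sum_comm (s := shapes k n), ← sum_congr rfl fun a _ => sum_shapes_downProb hα n a,
        sum_comm]
      refine sum_congr rfl fun r hr => ?_
      obtain ⟨hs, hr⟩ := mem_shapes.mp hr
      rw [← mul_sum, sum_downProb hα hr, ← hs]
      push_cast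
      ring
    have h2 : ∑ r ∈ shapes k n, (rowWeight α r)⁻¹ * ∑ a, upProb α r a ≤
        ∑ r ∈ shapes k n, (rowWeight α r)⁻¹ := by
      refine sum_le_sum fun r hr => ?_
      exact mul_le_of_le_one_right (inv_nonneg.mpr (rowWeight_pos hα r).le)
        (sum_upProb_le_one hα (mem_shapes.mp hr).2)
    calc α ^ (n + 1) * (n + 1).factorial * ∑ r ∈ shapes k (n + 1), (rowWeight α r)⁻¹
        = α ^ n * n.factorial *
          (α * ((n + 1 : ℕ) : ℝ) * ∑ r ∈ shapes k (n + 1), (rowWeight α r)⁻¹) := by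
          rw [Nat.factorial_succ]; push_cast; ring
      _ ≤ α ^ n * n.factorial * ∑ r ∈ shapes k n, (rowWeight α r)⁻¹ := by
          rw [h1]; gcongr
      _ ≤ 1 := ih

/-! ### Adding a full column -/

theorem prod_cast_sub_eq_factorial (k : ℕ) : ∏ i : Fin k, ((k : ℝ) - i) = k.factorial := by
  rw [← Finset.prod_range_add_one_eq_factorial, ← prod_range_reflect,
    Fin.prod_univ_eq_prod_range (fun i => (k : ℝ) - i), Nat.cast_prod]
  refine prod_congr rfl fun i hi => ?_
  have hi := mem_range.mp hi
  rw [show k - 1 - i + 1 = k - i by omega, Nat.cast_sub hi.le]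

theorem rowWeight_add_one {α : ℝ} {k : ℕ} (r : Fin k → ℕ) :
    rowWeight α (fun i => r i + 1) = rowWeight α r *
      ((∏ i : Fin k, (α * r i + ((k : ℝ) - i))) *
        ∏ i : Fin k, (α * r i + ((k : ℝ) - i - 1 + α))) := by
  unfold rowWeight
  simp only [rising_succ, Nat.add_sub_add_right, prod_mul_distrib]
  ring

theorem mul_factorial_sq_le_rowWeight_add_one {α : ℝ} (hα : 0 < α) {k : ℕ} (hk : 1 ≤ k)
    (r : Fin k → ℕ) :
    rowWeight α r * (α * (k.factorial : ℝ) ^ 2) ≤ k * rowWeight α (fun i => r i + 1) := by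
  have h1 : (k.factorial : ℝ) ≤ ∏ i : Fin k, (α * r i + ((k : ℝ) - i)) := by
    rw [← prod_cast_sub_eq_factorial]
    refine prod_le_prod (fun i _ => ?_) fun i _ => ?_
    · have := one_le_cast_sub i.isLt
      linarith
    · have : 0 ≤ α * (r i : ℝ) := by positivity
      linarith
  have h2 : α * (k.factorial : ℝ) ≤ k * ∏ i : Fin k, (α * r i + ((k : ℝ) - i - 1 + α)) := by
    obtain ⟨k, rfl⟩ : ∃ q, k = q + 1 := ⟨k - 1, by omega⟩
    rw [Fin.prod_univ_castSucc, Nat.factorial_succ, ← mul_assoc]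
    have h3 : (k.factorial : ℝ) ≤ ∏ i : Fin k, (α * r i.castSucc +
        (((k + 1 : ℕ) : ℝ) - (i.castSucc : ℕ) - 1 + α)) := by
      rw [← prod_cast_sub_eq_factorial]
      refine prod_le_prod (fun i _ => ?_) fun i _ => ?_
      · have := one_le_cast_sub i.isLt
        linarith
      · have : 0 ≤ α * (r i.castSucc : ℝ) := by positivity
        simp only [Fin.val_castSucc]
        push_cast
        linarith
    have h4 : α ≤ α * r (Fin.last k) + (((k + 1 : ℕ) : ℝ) - (Fin.last k : ℕ) - 1 + α) := by
      have : 0 ≤ α * (r (Fin.last k) : ℝ) := by positivity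
      simp only [Fin.val_last]
      push_cast
      linarith
    have h5 := mul_le_mul h3 h4 hα.le ((Nat.cast_nonneg _).trans h3)
    calc α * (((k + 1) * k.factorial : ℕ) : ℝ)
        = ((k + 1 : ℕ) : ℝ) * (k.factorial * α) := by push_cast; ring
      _ ≤ ((k + 1 : ℕ) : ℝ) * _ := mul_le_mul_of_nonneg_left h5 (Nat.cast_nonneg _)
      _ = _ := by ring
  rw [rowWeight_add_one]
  have h6 := mul_le_mul h1 h2 (by positivity) ((Nat.cast_nonneg _).trans h1)
  calc rowWeight α r * (α * (k.factorial : ℝ) ^ 2)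
      = rowWeight α r * (k.factorial * (α * k.factorial)) := by ring
    _ ≤ rowWeight α r * _ := mul_le_mul_of_nonneg_left h6 (rowWeight_pos hα r).le
    _ = _ := by ring

/-! ### Rows and columns of a partition -/

theorem colLen_antitone {n : ℕ} (lam : n.Partition) : Antitone (colLen lam) := fun _ _ hij =>
  Multiset.card_le_card (Multiset.monotone_filter_right _ fun _ h => lt_of_le_of_lt hij h)

theorem lt_of_lt_colLen {n : ℕ} {lam : n.Partition} {i j : ℕ} (h : i < colLen lam j) :
    j < n := by
  obtain ⟨p, hp⟩ := Multiset.card_pos_iff_exists_mem.mp (i.zero_le.trans_lt h)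
  obtain ⟨hp1, hp2⟩ := Multiset.mem_filter.mp hp
  exact hp2.trans_le ((Multiset.le_sum_of_mem hp1).trans_eq lam.parts_sum)

theorem lt_rowLen_iff {n : ℕ} {lam : n.Partition} {i j : ℕ} :
    j < rowLen lam i ↔ i < colLen lam j := by
  constructor
  · intro h
    by_contra hc
    refine absurd h (not_lt.mpr ?_)
    rw [← card_range j]
    refine card_le_card fun x hx => ?_
    have hx := (mem_filter.mp hx).2
    rw [mem_range]
    by_contra hjx
    exact hc (hx.trans_le (colLen_antitone lam (not_lt.mp hjx)))
  · intro h
    rw [← Nat.succ_le_iff, ← card_range j.succ]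
    refine card_le_card fun x hx => ?_
    have hxj : x ≤ j := Nat.lt_succ_iff.mp (mem_range.mp hx)
    exact mem_filter.mpr ⟨mem_range.mpr (hxj.trans_lt (lt_of_lt_colLen h)),
      h.trans_le (colLen_antitone lam hxj)⟩

theorem rowLen_antitone {n : ℕ} (lam : n.Partition) : Antitone (rowLen lam) := fun i j hij => by
  by_contra! h
  have h1 := lt_rowLen_iff.mp h
  exact lt_irrefl _ (lt_rowLen_iff.mpr (hij.trans_lt h1))

theorem rowLen_eq_zero {n : ℕ} {lam : n.Partition} {i : ℕ} (h : colLen lam 0 ≤ i) :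
    rowLen lam i = 0 := by
  by_contra h0
  have := lt_rowLen_iff.mp (Nat.pos_of_ne_zero h0)
  omega

theorem colLen_zero_eq_card {n : ℕ} (lam : n.Partition) :
    colLen lam 0 = Multiset.card lam.parts := by
  unfold colLen
  rw [Multiset.filter_eq_self.mpr fun p hp => lam.parts_pos hp]

theorem colLen_zero_le {n : ℕ} (lam : n.Partition) : colLen lam 0 ≤ n := by
  have h := Multiset.card_nsmul_le_sum (s := lam.parts) (a := 1) fun p hp => lam.parts_pos hp
  rw [colLen_zero_eq_card]
  simpa [lam.parts_sum] using h

theorem colLen_zero_pos {n : ℕ} (hn : 1 ≤ n) (lam : n.Partition) : 0 < colLen lam 0 := by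
  rw [colLen_zero_eq_card, Multiset.card_pos]
  intro h
  have := lam.parts_sum
  rw [h, Multiset.sum_zero] at this
  omega

theorem sum_range_card_filter_lt (N : ℕ) (s : Multiset ℕ) (hs : ∀ p ∈ s, p ≤ N) :
    ∑ j ∈ range N, Multiset.card (s.filter (fun p => j < p)) = s.sum := by
  induction s using Multiset.induction_on with
  | empty => simp
  | cons a s ih =>
    simp only [← Multiset.countP_eq_card_filter, Multiset.countP_cons, sum_add_distrib] at ih ⊢
    rw [ih fun p hp => hs p (Multiset.mem_cons_of_mem hp), Multiset.sum_cons, add_comm,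
      ← card_filter]
    congr 1
    have ha := hs a (Multiset.mem_cons_self a s)
    rw [show (range N).filter (fun j => j < a) = range a by
      ext j; simp only [mem_filter, mem_range]; omega, card_range]

theorem sum_rowLen {n : ℕ} (lam : n.Partition) {l : ℕ} (hl : colLen lam 0 = l) :
    ∑ i ∈ range l, rowLen lam i = n := by
  calc ∑ i ∈ range l, rowLen lam i
      = ∑ i ∈ range l, ∑ j ∈ range n, if i < colLen lam j then 1 else 0 :=
        sum_congr rfl fun i _ => by rw [rowLen, card_filter]
    _ = ∑ j ∈ range n, ∑ i ∈ range l, if i < colLen lam j then 1 else 0 := sum_comm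
    _ = ∑ j ∈ range n, colLen lam j := by
        refine sum_congr rfl fun j _ => ?_
        have := colLen_antitone lam j.zero_le
        rw [← card_filter, show (range l).filter (fun i => i < colLen lam j) =
          range (colLen lam j) by
            ext i; simp only [mem_filter, mem_range]; omega, card_range]
    _ = n := by
        unfold colLen
        rw [sum_range_card_filter_lt n _ fun p hp =>
          (Multiset.le_sum_of_mem hp).trans_eq lam.parts_sum, lam.parts_sum]

theorem partition_ext_of_rowLen {n : ℕ} {lam mu : n.Partition}
    (h : ∀ i, rowLen lam i = rowLen mu i) : lam = mu := by
  have hc : ∀ j, colLen lam j = colLen mu j := fun j =>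
    eq_of_forall_lt_iff fun i => by rw [← lt_rowLen_iff, ← lt_rowLen_iff, h]
  have hcount : ∀ (s : Multiset ℕ) (p : ℕ), Multiset.card (s.filter (fun q => p < q)) =
      s.count (p + 1) + Multiset.card (s.filter (fun q => p + 1 < q)) := by
    intro s p
    induction s using Multiset.induction_on with
    | empty => simp
    | cons a s ih =>
      simp only [← Multiset.countP_eq_card_filter, Multiset.countP_cons,
        Multiset.count_cons] at ih ⊢
      rw [ih]
      split_ifs <;> omega
  ext p
  rcases p with _ | p
  · rw [Multiset.count_eq_zero_of_notMem fun h0 => lt_irrefl _ (lam.parts_pos h0),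
      Multiset.count_eq_zero_of_notMem fun h0 => lt_irrefl _ (mu.parts_pos h0)]
  · have h1 := hc p
    have h2 := hc (p + 1)
    unfold colLen at h1 h2
    rw [hcount, hcount mu.parts] at h1
    omega

/-! ### The hook products of a partition -/

theorem prod_Ico_eq_rising (α t : ℝ) {a b : ℕ} :
    ∏ j ∈ Ico b a, (α * ((a - (j + 1) : ℕ) : ℝ) + t) = rising α t (a - b) := by
  rw [prod_Ico_eq_prod_range, rising, ← prod_range_reflect]
  refine prod_congr rfl fun j hj => ?_
  have hj := mem_range.mp hj
  rw [show a - (b + (a - b - 1 - j) + 1) = j by omega]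

theorem prod_Ico_hook {α β : ℝ} (hα : 0 < α) (hβ : 0 < β) {n : ℕ} (lam : n.Partition)
    {i m : ℕ} (him : i ≤ m) :
    ∏ j ∈ Ico (rowLen lam m) (rowLen lam i),
        (α * arm lam (i, j) + leg lam (i, j) + β) =
      rising α ((m : ℝ) - i - 1 + β) (rowLen lam i - rowLen lam m) *
        ∏ q ∈ Ico i m, (rising α ((q : ℝ) - i - 1 + β) (rowLen lam i - rowLen lam q) /
          rising α ((q : ℝ) - i + β) (rowLen lam i - rowLen lam q)) := by
  induction m, him using Nat.le_induction with
  | base => simp [rising_zero]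
  | succ m him ih =>
    have hm : rowLen lam (m + 1) ≤ rowLen lam m := rowLen_antitone lam m.le_succ
    have hi : rowLen lam m ≤ rowLen lam i := rowLen_antitone lam him
    have him' : (i : ℝ) ≤ m := by exact_mod_cast him
    have hpos := rising_pos hα (show 0 < (m : ℝ) - i + β by linarith)
      (rowLen lam i - rowLen lam m)
    rw [← prod_Ico_consecutive _ hm hi, ih, prod_Ico_succ_top him]
    have hblock : ∏ j ∈ Ico (rowLen lam (m + 1)) (rowLen lam m),
        (α * arm lam (i, j) + leg lam (i, j) + β) =
        rising α ((m : ℝ) - i + β) (rowLen lam i - rowLen lam (m + 1)) /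
          rising α ((m : ℝ) - i + β) (rowLen lam i - rowLen lam m) := by
      rw [eq_div_iff hpos.ne', ← prod_Ico_eq_rising, ← prod_Ico_eq_rising,
        ← prod_Ico_consecutive _ hm hi]
      congr 1
      refine prod_congr rfl fun j hj => ?_
      obtain ⟨hj1, hj2⟩ := mem_Ico.mp hj
      have h1 := lt_rowLen_iff.mp hj2
      have h2 := mt lt_rowLen_iff.mpr (not_lt.mpr hj1)
      unfold arm leg
      simp only
      rw [show colLen lam j - (i + 1) = m - i by omega, Nat.cast_sub him]
      ring
    rw [hblock, show ((m + 1 : ℕ) : ℝ) - i - 1 + β = (m : ℝ) - i + β by push_cast; ring]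
    ring

theorem prod_cells {n : ℕ} (lam : n.Partition) {l : ℕ} (hl : colLen lam 0 = l)
    (f : ℕ × ℕ → ℝ) :
    ∏ s ∈ cells lam, f s = ∏ i : Fin l, ∏ j ∈ range (rowLen lam i), f (i, j) := by
  rw [Fin.prod_univ_eq_prod_range (fun i => ∏ j ∈ range (rowLen lam i), f (i, j))]
  refine prod_finset_product _ _ _ fun p => ?_
  unfold cells
  simp only [mem_filter, mem_product, mem_range]
  constructor
  · rintro ⟨-, h⟩
    exact ⟨hl ▸ (lt_rowLen_iff.mp h).trans_le (colLen_antitone lam (Nat.zero_le _)), h⟩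
  · rintro ⟨h1, h2⟩
    exact ⟨⟨h1.trans_le (hl ▸ colLen_zero_le lam), lt_of_lt_colLen (lt_rowLen_iff.mp h2)⟩, h2⟩

theorem prod_cells_hook {α β : ℝ} (hα : 0 < α) (hβ : 0 < β) {n : ℕ} (lam : n.Partition)
    {l : ℕ} (hl : colLen lam 0 = l) :
    ∏ s ∈ cells lam, (α * arm lam s + leg lam s + β) =
      (∏ i : Fin l, rising α ((l : ℝ) - i - 1 + β) (rowLen lam i)) *
        ∏ i : Fin l, ∏ m : Fin l, if i < m then
          rising α ((m : ℝ) - i - 1 + β) (rowLen lam i - rowLen lam m) /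
            rising α ((m : ℝ) - i + β) (rowLen lam i - rowLen lam m) else 1 := by
  rw [prod_cells lam hl, ← prod_mul_distrib]
  refine prod_congr rfl fun i _ => ?_
  have h := prod_Ico_hook hα hβ lam i.isLt.le
  rw [rowLen_eq_zero hl.le, Nat.sub_zero, ← range_eq_Ico] at h
  rw [h]
  congr 1
  simp only [Fin.lt_def]
  rw [Fin.prod_univ_eq_prod_range (fun m => if (i : ℕ) < m then
    rising α ((m : ℝ) - i - 1 + β) (rowLen lam i - rowLen lam m) /
      rising α ((m : ℝ) - i + β) (rowLen lam i - rowLen lam m) else 1), ← prod_filter]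
  symm
  refine prod_subset (fun m hm => ?_) fun m hm hm' => ?_
  · simp only [mem_filter, mem_range] at hm
    exact mem_Ico.mpr ⟨hm.2.le, hm.1⟩
  · simp only [mem_filter, mem_range, mem_Ico] at hm hm'
    rw [show m = i by omega]
    simp [rising_zero]

theorem cLow_mul_cUp {α : ℝ} (hα : 0 < α) {n : ℕ} (lam : n.Partition)
    {l : ℕ} (hl : colLen lam 0 = l) :
    cLow α lam * cUp α lam = rowWeight α (fun i : Fin l => rowLen lam i) := by
  unfold cLow cUp rowWeight
  rw [prod_cells_hook hα one_pos lam hl, prod_cells_hook hα hα lam hl, mul_mul_mul_comm]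
  simp only [← prod_mul_distrib, sub_add_cancel]
  refine prod_congr rfl fun i _ => congrArg _ (prod_congr rfl fun m _ => ?_)
  unfold pairFactor
  split_ifs <;> simp

/-! ### The tail bound -/

theorem sum_jackP_colLen_eq_le {α : ℝ} (hα : 0 < α) {n l : ℕ} (hl : 1 ≤ l) (hln : l ≤ n) :
    ∑ lam : n.Partition with colLen lam 0 = l, jackP α lam ≤
      l / α * ((α * n) ^ l / (l.factorial : ℝ) ^ 2) := by
  set φ : n.Partition → Fin l → ℕ := fun lam i => rowLen lam i - 1 with hφ
  have hone : ∀ lam : n.Partition, colLen lam 0 = l → ∀ i : ℕ, i < l →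
      rowLen lam i - 1 + 1 = rowLen lam i := fun lam h i hi =>
    Nat.sub_add_cancel (lt_rowLen_iff.mpr (h ▸ hi))
  have hinj : Set.InjOn φ ({lam : n.Partition | colLen lam 0 = l} : Finset n.Partition) := by
    intro lam h1 mu h2 h
    simp only [coe_filter, mem_univ, true_and, Set.mem_ofPred_eq] at h1 h2
    refine partition_ext_of_rowLen fun i => ?_
    rcases lt_or_ge i l with hi | hi
    · rw [← hone lam h1 i hi, ← hone mu h2 i hi]
      exact congrArg (· + 1) (congrFun h ⟨i, hi⟩)
    · rw [rowLen_eq_zero (h1.trans_le hi), rowLen_eq_zero (h2.trans_le hi)]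
  have hmaps : ∀ lam ∈ ({lam : n.Partition | colLen lam 0 = l} : Finset n.Partition),
      φ lam ∈ shapes l (n - l) := by
    intro lam h
    have h := (mem_filter.mp h).2
    refine mem_shapes.mpr ⟨?_, fun i j hij =>
      Nat.sub_le_sub_right (rowLen_antitone lam hij) 1⟩
    have h1 := sum_rowLen lam h
    rw [← Fin.sum_univ_eq_sum_range, ← sum_congr rfl fun (i : Fin l) _ => hone lam h i i.isLt,
      sum_add_distrib] at h1
    simp only [sum_const, card_univ, Fintype.card_fin, smul_eq_mul, mul_one] at h1
    simp only [hφ]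
    omega
  have hterm : ∀ lam ∈ ({lam : n.Partition | colLen lam 0 = l} : Finset n.Partition),
      jackP α lam ≤ α ^ n * n.factorial * (l / (α * (l.factorial : ℝ) ^ 2)) *
        (rowWeight α (φ lam))⁻¹ := by
    intro lam h
    have h := (mem_filter.mp h).2
    have hW := rowWeight_pos hα (φ lam)
    have hb := mul_factorial_sq_le_rowWeight_add_one hα hl (φ lam)
    have he : (fun i : Fin l => φ lam i + 1) = fun i : Fin l => rowLen lam i :=
      funext fun i => hone lam h i i.isLt
    rw [he] at hb
    have hW' := rowWeight_pos hα (fun i : Fin l => rowLen lam i)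
    unfold jackP
    rw [cLow_mul_cUp hα lam h, mul_assoc (α ^ n * (n.factorial : ℝ)), div_eq_mul_inv]
    refine mul_le_mul_of_nonneg_left ?_ (by positivity)
    have hf : 0 < α * (l.factorial : ℝ) ^ 2 := by positivity
    rw [← div_eq_mul_inv, div_div, inv_eq_one_div, div_le_div_iff₀ hW' (by positivity)]
    linarith
  have hdesc : (n.factorial : ℝ) ≤ (n - l).factorial * (n : ℝ) ^ l := by
    rw [← Nat.factorial_mul_descFactorial hln]
    push_cast
    exact mul_le_mul_of_nonneg_left (by exact_mod_cast Nat.descFactorial_le_pow n l)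
      (Nat.cast_nonneg _)
  have hsum : ∑ lam : n.Partition with colLen lam 0 = l, (rowWeight α (φ lam))⁻¹ ≤
      ∑ r ∈ shapes l (n - l), (rowWeight α r)⁻¹ := by
    rw [← sum_image (f := fun r => (rowWeight α r)⁻¹) hinj]
    exact sum_le_sum_of_subset_of_nonneg (image_subset_iff.mpr hmaps)
      fun r _ _ => (inv_pos.mpr (rowWeight_pos hα r)).le
  have hS : 0 ≤ ∑ r ∈ shapes l (n - l), (rowWeight α r)⁻¹ :=
    sum_nonneg fun r _ => (inv_pos.mpr (rowWeight_pos hα r)).le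
  calc ∑ lam : n.Partition with colLen lam 0 = l, jackP α lam
      ≤ α ^ n * n.factorial * (l / (α * (l.factorial : ℝ) ^ 2)) *
          ∑ r ∈ shapes l (n - l), (rowWeight α r)⁻¹ := by
        refine (sum_le_sum hterm).trans ?_
        rw [← mul_sum]
        exact mul_le_mul_of_nonneg_left hsum (by positivity)
    _ ≤ α ^ n * ((n - l).factorial * (n : ℝ) ^ l) * (l / (α * (l.factorial : ℝ) ^ 2)) *
          ∑ r ∈ shapes l (n - l), (rowWeight α r)⁻¹ := by gcongr
    _ = l / α * ((α * n) ^ l / (l.factorial : ℝ) ^ 2) *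
          (α ^ (n - l) * (n - l).factorial * ∑ r ∈ shapes l (n - l), (rowWeight α r)⁻¹) := by
        have : α ^ n = α ^ (n - l) * α ^ l := by rw [← pow_add, Nat.sub_add_cancel hln]
        rw [this, mul_pow]
        field_simp
    _ ≤ l / α * ((α * n) ^ l / (l.factorial : ℝ) ^ 2) :=
        mul_le_of_le_one_right (by positivity) (sum_inv_rowWeight_le hα l (n - l))

theorem pow_div_factorial_sq_le {x : ℝ} (hx : 0 ≤ x) {l : ℕ}
    (h : 2 * Real.exp 1 * Real.sqrt x ≤ l) :
    x ^ l / (l.factorial : ℝ) ^ 2 ≤ 1 / 4 ^ l := by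
  have h1 : (l : ℝ) ^ l / l.factorial ≤ Real.exp l :=
    Real.pow_div_factorial_le_exp _ (Nat.cast_nonneg l) l
  have hf : (0 : ℝ) < l.factorial := by positivity
  have h2 : (2 * Real.exp 1 * Real.sqrt x) ^ l ≤ Real.exp l * l.factorial :=
    (pow_le_pow_left₀ (by positivity) h l).trans ((div_le_iff₀ hf).mp h1)
  have h3 : (2 * Real.sqrt x) ^ l ≤ l.factorial := by
    have he : (2 * Real.exp 1 * Real.sqrt x) ^ l = Real.exp l * (2 * Real.sqrt x) ^ l := by
      rw [show 2 * Real.exp 1 * Real.sqrt x = Real.exp 1 * (2 * Real.sqrt x) by ring, mul_pow,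
        ← Real.exp_nat_mul, mul_one]
    rw [he] at h2
    exact le_of_mul_le_mul_left h2 (Real.exp_pos _)
  have h4 := pow_le_pow_left₀ (by positivity) h3 2
  rw [← pow_mul, mul_comm l 2, pow_mul, mul_pow, Real.sq_sqrt hx, mul_pow] at h4
  rw [div_le_div_iff₀ (by positivity) (by positivity)]
  norm_num at h4 ⊢
  linarith

/-- Tail bound for the number of parts `λ₁'` under Jack measure. -/
theorem jack_tail_lambda1' (α : ℝ) (hα : 0 < α) (n : ℕ) (hn : 1 ≤ n) :
    (∑ lam : n.Partition,
        if 2 * Real.exp 1 * Real.sqrt (α * n) ≤ (colLen lam 0 : ℝ) then jackP α lam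
        else 0) ≤
      (n : ℝ) ^ 2 / (α * (4 : ℝ) ^ (2 * Real.exp 1 * Real.sqrt (α * n))) := by
  set L : ℝ := 2 * Real.exp 1 * Real.sqrt (α * n) with hL
  rw [← sum_fiberwise_of_maps_to (s := univ) (t := Icc 1 n) (g := fun lam => colLen lam 0)
    fun lam _ => mem_Icc.mpr ⟨colLen_zero_pos hn lam, colLen_zero_le lam⟩]
  have hpow : (0 : ℝ) < 4 ^ L := Real.rpow_pos_of_pos (by norm_num) L
  have hterm : ∀ l ∈ Icc 1 n, (∑ lam : n.Partition with colLen lam 0 = l,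
      if L ≤ (colLen lam 0 : ℝ) then jackP α lam else 0) ≤ n / α * (1 / 4 ^ L) := by
    intro l hl
    obtain ⟨hl1, hln⟩ := mem_Icc.mp hl
    have hln' : (l : ℝ) ≤ n := by exact_mod_cast hln
    by_cases hLl : L ≤ l
    · rw [sum_congr rfl fun lam hlam => if_pos (by rw [(mem_filter.mp hlam).2]; exact hLl)]
      refine (sum_jackP_colLen_eq_le hα hl1 hln).trans ?_
      have h1 := pow_div_factorial_sq_le (x := α * n) (by positivity) hLl
      have h2 : (1 : ℝ) / 4 ^ l ≤ 1 / 4 ^ L := by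
        rw [← Real.rpow_natCast]
        exact one_div_le_one_div_of_le hpow
          (Real.rpow_le_rpow_of_exponent_le (by norm_num) hLl)
      exact mul_le_mul (by gcongr) (h1.trans h2) (by positivity) (by positivity)
    · rw [sum_eq_zero fun lam hlam => if_neg (by rw [(mem_filter.mp hlam).2]; exact hLl)]
      positivity
  refine (sum_le_sum hterm).trans_eq ?_
  rw [sum_const, Nat.card_Icc, Nat.add_sub_cancel, nsmul_eq_mul]
  field_simp

end JackTest
end

section
/- Let α > 0 and n ≥ 2, and suppose the partition ρ of n is obtained from the partition λ of n by moving a single box: the Young diagram of ρ is obtained from that of λ by removing the box in row a and column b and adding a box in row c and column d, where c ≠ a. Then W_α(ρ) − W_α(λ) = (α·(λ_c − λ_a + 1) + (λ'_b − λ'_d − 1))/√(α·C(n,2)), where λ_i denotes the i-th part of λ and λ'_j the j-th part of the conjugate partition λ'. -/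
open Finset

namespace JackTest

theorem colLen_le {n : ℕ} (lam : n.Partition) (j : ℕ) : colLen lam j ≤ n := by
  calc colLen lam j ≤ lam.parts.card := Multiset.card_le_card (Multiset.filter_le _ _)
    _ = lam.parts.card • 1 := by simp
    _ ≤ lam.parts.sum := Multiset.card_nsmul_le_sum fun _ hp => lam.parts_pos hp
    _ = n := lam.parts_sum

theorem colLen_eq_zero {n : ℕ} (lam : n.Partition) {j : ℕ} (hj : n ≤ j) : colLen lam j = 0 := by
  rw [colLen, Multiset.card_eq_zero, Multiset.filter_eq_nil]
  intro p hp
  have h := Multiset.le_sum_of_mem hp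
  rw [lam.parts_sum] at h
  omega

theorem rowLen_le {n : ℕ} (lam : n.Partition) (i : ℕ) : rowLen lam i ≤ n := by
  simpa [rowLen] using card_filter_le (range n) (fun j => i < colLen lam j)

theorem lt_rowLen_iff_lt_colLen {n : ℕ} (lam : n.Partition) (i j : ℕ) :
    j < rowLen lam i ↔ i < colLen lam j := by
  constructor
  · intro h
    by_contra! hij
    have hsub : (range n).filter (fun k => i < colLen lam k) ⊆ range j := by
      intro k hk
      rw [mem_filter] at hk
      by_contra hkj
      rw [mem_range, not_lt] at hkj
      exact (hij.trans_lt hk.2).not_ge (colLen_antitone lam hkj)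
    have hcard := card_le_card hsub
    rw [card_range] at hcard
    exact h.not_ge hcard
  · intro h
    have hjn : j < n := by
      by_contra! hnj
      simp [colLen_eq_zero lam hnj] at h
    have hsub : range (j + 1) ⊆ (range n).filter (fun k => i < colLen lam k) := by
      intro k hk
      rw [mem_range] at hk
      exact mem_filter.2 ⟨mem_range.2 (by omega),
        h.trans_le (colLen_antitone lam (Nat.le_of_lt_succ hk))⟩
    have hcard := card_le_card hsub
    rwa [card_range] at hcard

theorem mem_cells_iff_lt_rowLen {n : ℕ} (lam : n.Partition) (i j : ℕ) :
    (i, j) ∈ cells lam ↔ j < rowLen lam i := by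
  simp only [cells, mem_filter, mem_product, mem_range, and_iff_right_iff_imp]
  intro h
  exact ⟨((lt_rowLen_iff_lt_colLen lam i j).1 h).trans_le (colLen_le lam j),
    h.trans_le (rowLen_le lam i)⟩

theorem mem_cells_iff_lt_colLen {n : ℕ} (lam : n.Partition) (i j : ℕ) :
    (i, j) ∈ cells lam ↔ i < colLen lam j :=
  (mem_cells_iff_lt_rowLen lam i j).trans (lt_rowLen_iff_lt_colLen lam i j)

theorem filter_range_lt_eq {n m : ℕ} (h : m ≤ n) : (range n).filter (· < m) = range m := by
  ext k
  simp only [mem_filter, mem_range]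
  omega

theorem nStat_eq_sum_cells {n : ℕ} (lam : n.Partition) : nStat lam = ∑ s ∈ cells lam, s.1 := by
  rw [nStat, cells, sum_filter, sum_product]
  refine sum_congr rfl fun i _ => ?_
  rw [← sum_filter, filter_range_lt_eq (rowLen_le lam i), sum_const, card_range, smul_eq_mul,
    mul_comm]

theorem nStatConj_eq_sum_cells {n : ℕ} (lam : n.Partition) :
    nStatConj lam = ∑ s ∈ cells lam, s.2 := by
  rw [nStatConj, cells, sum_filter, sum_product_right]
  refine sum_congr rfl fun j _ => ?_
  simp only [lt_rowLen_iff_lt_colLen]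
  rw [← sum_filter, filter_range_lt_eq (colLen_le lam j), sum_const, card_range, smul_eq_mul,
    mul_comm]

theorem sum_insert_erase_add {ι M : Type*} [DecidableEq ι] [AddCommMonoid M] {s : Finset ι}
    {x y : ι} (hx : x ∈ s) (hy : y ∉ s) (f : ι → M) :
    ∑ z ∈ insert y (s.erase x), f z + f x = ∑ z ∈ s, f z + f y := by
  rw [sum_insert fun h => hy (mem_of_mem_erase h), add_assoc, sum_erase_add _ _ hx, add_comm]

section BoxMove

variable {n : ℕ} {lam rho : n.Partition} {a b c d : ℕ}

theorem rowLen_of_box_removed (hca : c ≠ a) (hrem : (a, b) ∈ cells lam)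
    (hrho : cells rho = insert (c, d) ((cells lam).erase (a, b))) :
    rowLen lam a = b + 1 := by
  have h₀ := Finset.ext_iff.1 hrho (a, b)
  have h₁ := Finset.ext_iff.1 hrho (a, b + 1)
  simp only [mem_insert, mem_erase, mem_cells_iff_lt_rowLen, Prod.mk.injEq, ne_eq] at h₀ h₁ hrem
  grind

theorem colLen_of_box_removed (hca : c ≠ a) (hrem : (a, b) ∈ cells lam)
    (hrho : cells rho = insert (c, d) ((cells lam).erase (a, b))) :
    colLen lam b = a + 1 := by
  have h₀ := Finset.ext_iff.1 hrho (a, b)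
  have h₁ := Finset.ext_iff.1 hrho (a + 1, b)
  simp only [mem_insert, mem_erase, mem_cells_iff_lt_colLen, Prod.mk.injEq, ne_eq] at h₀ h₁ hrem
  grind

theorem rowLen_of_box_added (hadd : (c, d) ∉ cells lam)
    (hrho : cells rho = insert (c, d) ((cells lam).erase (a, b))) :
    rowLen lam c = d := by
  have h₀ := Finset.ext_iff.1 hrho (c, d)
  have h₁ := Finset.ext_iff.1 hrho (c, rowLen lam c)
  simp only [mem_insert, mem_erase, mem_cells_iff_lt_rowLen, Prod.mk.injEq, ne_eq] at h₀ h₁ hadd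
  grind

theorem colLen_of_box_added (hadd : (c, d) ∉ cells lam)
    (hrho : cells rho = insert (c, d) ((cells lam).erase (a, b))) :
    colLen lam d = c := by
  have h₀ := Finset.ext_iff.1 hrho (c, d)
  have h₁ := Finset.ext_iff.1 hrho (colLen lam d, d)
  simp only [mem_insert, mem_erase, mem_cells_iff_lt_colLen, Prod.mk.injEq, ne_eq] at h₀ h₁ hadd
  grind

theorem nStat_add_of_box_move (hrem : (a, b) ∈ cells lam) (hadd : (c, d) ∉ cells lam)
    (hrho : cells rho = insert (c, d) ((cells lam).erase (a, b))) :
    nStat rho + a = nStat lam + c := by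
  simpa only [nStat_eq_sum_cells, hrho] using sum_insert_erase_add hrem hadd Prod.fst

theorem nStatConj_add_of_box_move (hrem : (a, b) ∈ cells lam) (hadd : (c, d) ∉ cells lam)
    (hrho : cells rho = insert (c, d) ((cells lam).erase (a, b))) :
    nStatConj rho + b = nStatConj lam + d := by
  simpa only [nStatConj_eq_sum_cells, hrho] using sum_insert_erase_add hrem hadd Prod.snd

end BoxMove

/-- Formula for the change of `W_α` when a box is moved from row `a`, column `b`
to row `c`, column `d` (rows and columns are `1`-indexed). -/
theorem W_diff_of_box_move (α : ℝ) (hα : 0 < α) (n : ℕ) (hn : 2 ≤ n)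
    (lam rho : n.Partition) (a b c d : ℕ)
    (ha : 1 ≤ a) (hb : 1 ≤ b) (hc : 1 ≤ c) (hd : 1 ≤ d) (hca : c ≠ a)
    (hrem : (a - 1, b - 1) ∈ cells lam) (hadd : (c - 1, d - 1) ∉ cells lam)
    (hrho : cells rho = insert (c - 1, d - 1) ((cells lam).erase (a - 1, b - 1))) :
    W α rho - W α lam =
      (α * ((rowLen lam (c - 1) : ℝ) - rowLen lam (a - 1) + 1) +
        ((colLen lam (b - 1) : ℝ) - colLen lam (d - 1) - 1)) /
        Real.sqrt (α * n.choose 2) := by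
  have hca' : c - 1 ≠ a - 1 := by omega
  have hn₁ : (nStat rho + (a - 1 : ℕ) : ℝ) = nStat lam + (c - 1 : ℕ) := by
    exact_mod_cast nStat_add_of_box_move hrem hadd hrho
  have hn₂ : (nStatConj rho + (b - 1 : ℕ) : ℝ) = nStatConj lam + (d - 1 : ℕ) := by
    exact_mod_cast nStatConj_add_of_box_move hrem hadd hrho
  rw [rowLen_of_box_removed hca' hrem hrho, colLen_of_box_removed hca' hrem hrho,
    rowLen_of_box_added hadd hrho, colLen_of_box_added hadd hrho, W, W, ← sub_div]
  congr 1
  simp only [Nat.cast_add, Nat.cast_one]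
  linear_combination α * hn₂ - hn₁

end JackTest
end
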